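/- arXiv:1304.3886 — 3 statements merged into one kernel-verified Lean document; each statement's English description precedes it below -/
import Mathlib

section
/- (Modified CRB-type bound for the SSNM.) Consider the SSNM. Let x₀ ∈ X_S and let K ⊆ {1,…,N} be nonempty with |K| ≤ S. Let x₀^K ∈ ℝ^N denote the vector obtained from x₀ by zeroing all entries except those indexed by K. Let ĝ : ℝ^N → ℝ be Borel measurable, P_x-integrable for every x ∈ X_S, with ∫ ĝ² dP_{x₀} < ∞; write γ(x) = ∫ ĝ dP_x for x ∈ X_S. Suppose that for each l ∈ K the map t ↦ γ(x₀^K + t e_l) is differentiable at t = 0 with derivative b_l. Then v(ĝ; x₀) ≥ exp(−(1/σ²) · Σ_{l∈supp(x₀)∖K} (x₀)_l²) · σ² · Σ_{l∈K} b_l². -/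
open MeasureTheory ProbabilityTheory

/-- The distribution `P_x` of `y = x + n` where `n` has i.i.d. `N(0,σ²)` entries
(sparse signal in noise model, SSNM). -/
noncomputable def ssnmP {N : ℕ} (σ : ℝ) (x : Fin N → ℝ) : Measure (Fin N → ℝ) :=
  Measure.map (fun n => x + n)
    (Measure.pi fun _ : Fin N => gaussianReal 0 ((σ ^ 2).toNNReal))

/-- The set `X_S` of `S`-sparse parameter vectors. -/
def sparseSet (N S : ℕ) : Set (Fin N → ℝ) := {x | (Function.support x).ncard ≤ S}

/-- Mean function `γ_ĝ(x) = ∫ ĝ dP_x` of an estimator. -/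
noncomputable def ssnmMean {N : ℕ} (σ : ℝ) (g : (Fin N → ℝ) → ℝ) (x : Fin N → ℝ) : ℝ :=
  ∫ y, g y ∂ ssnmP σ x

/-- Variance `v(ĝ;x) = ∫ (ĝ(y) − γ_ĝ(x))² dP_x(y)` of an estimator. -/
noncomputable def ssnmVar {N : ℕ} (σ : ℝ) (g : (Fin N → ℝ) → ℝ) (x : Fin N → ℝ) : ℝ :=
  ∫ y, (g y - ssnmMean σ g x) ^ 2 ∂ ssnmP σ x

open scoped ENNReal

/-- A product of measures with densities has the product density. -/
lemma pi_withDensity_eq {ι : Type*} [Fintype ι] {α : ι → Type*} [∀ i, MeasurableSpace (α i)]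
    (μ : ∀ i, Measure (α i)) [∀ i, IsProbabilityMeasure (μ i)] {f : ∀ i, α i → ℝ≥0∞}
    (hf : ∀ i, Measurable (f i)) [∀ i, SigmaFinite ((μ i).withDensity (f i))] :
    Measure.pi (fun i => (μ i).withDensity (f i))
      = (Measure.pi μ).withDensity (fun x => ∏ i, f i (x i)) := by
  refine Measure.pi_eq fun s hs => ?_
  have hm (i : ι) : Measurable ((s i).indicator (f i)) := (hf i).indicator (hs i)
  have hind (x : ∀ i, α i) : (Set.univ.pi s).indicator (fun x => ∏ i, f i (x i)) x
      = ∏ i, (s i).indicator (f i) (x i) := by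
    by_cases hx : x ∈ Set.univ.pi s
    · rw [Set.indicator_of_mem hx]
      exact Finset.prod_congr rfl fun i _ =>
        (Set.indicator_of_mem (hx i (Set.mem_univ i)) (f i)).symm
    · rw [Set.indicator_of_notMem hx]
      obtain ⟨i, hi⟩ : ∃ i, x i ∉ s i := by simpa [Set.mem_pi] using hx
      exact (Finset.prod_eq_zero (Finset.mem_univ i) (Set.indicator_of_notMem hi _)).symm
  rw [withDensity_apply _ (.univ_pi hs), ← lintegral_indicator (.univ_pi hs)]
  simp_rw [hind]
  rw [lintegral_prod_eq_prod_lintegral_of_indepFun Finset.univ _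
    (iIndepFun_pi fun i => (hm i).aemeasurable) fun i => (hm i).comp (measurable_pi_apply i)]
  refine Finset.prod_congr rfl fun i _ => ?_
  rw [(measurePreserving_eval μ i).lintegral_comp (hm i), lintegral_indicator (hs i),
    withDensity_apply _ (hs i)]

lemma gaussianReal_eq_withDensity_gaussianReal_zero (u : ℝ) {σ : ℝ} (hσ : 0 < σ) :
    gaussianReal u (σ ^ 2).toNNReal = (gaussianReal 0 (σ ^ 2).toNNReal).withDensity
      (fun x => ENNReal.ofReal (Real.exp ((u * x - u * u / 2) / σ ^ 2))) := by
  have hv : (σ ^ 2).toNNReal ≠ 0 := by simp [hσ.ne']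
  rw [gaussianReal_of_var_ne_zero _ hv, gaussianReal_of_var_ne_zero _ hv,
    ← withDensity_mul _ (measurable_gaussianPDF _ _) (by fun_prop)]
  congr 1
  ext x
  rw [Pi.mul_apply, gaussianPDF, gaussianPDF, ← ENNReal.ofReal_mul (gaussianPDFReal_nonneg _ _ _),
    gaussianPDFReal, gaussianPDFReal, mul_assoc _ (Real.exp _), ← Real.exp_add,
    Real.coe_toNNReal _ (sq_nonneg σ)]
  congr 4
  field_simp
  ring

/-- The noise distribution: a product of centered Gaussians of variance `σ²`. -/
noncomputable def ssnmNoise (N : ℕ) (σ : ℝ) : Measure (Fin N → ℝ) :=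
  Measure.pi fun _ : Fin N => gaussianReal 0 ((σ ^ 2).toNNReal)

instance (N : ℕ) (σ : ℝ) : IsProbabilityMeasure (ssnmNoise N σ) := by
  unfold ssnmNoise
  infer_instance

/-- The likelihood ratio of the noise shifted by `u` with respect to the noise. -/
noncomputable def ssnmRatio {N : ℕ} (σ : ℝ) (u n : Fin N → ℝ) : ℝ :=
  Real.exp ((u ⬝ᵥ n - u ⬝ᵥ u / 2) / σ ^ 2)

lemma measurable_ssnmRatio {N : ℕ} (σ : ℝ) (u : Fin N → ℝ) : Measurable (ssnmRatio σ u) := by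
  unfold ssnmRatio dotProduct
  fun_prop

/-- The Cameron–Martin formula for the noise. -/
lemma map_add_ssnmNoise {N : ℕ} {σ : ℝ} (hσ : 0 < σ) (u : Fin N → ℝ) :
    (ssnmNoise N σ).map (fun n => u + n)
      = (ssnmNoise N σ).withDensity (fun n => ENNReal.ofReal (ssnmRatio σ u n)) := by
  have h1 : (ssnmNoise N σ).map (fun n => u + n)
      = Measure.pi fun i => gaussianReal (u i) (σ ^ 2).toNNReal := by
    have h := Measure.pi_map_pi (μ := fun _ : Fin N => gaussianReal 0 (σ ^ 2).toNNReal)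
      (f := fun i x => u i + x)
      (hμ := fun i => by rw [gaussianReal_map_const_add]; infer_instance)
      fun i => by fun_prop
    simp only [gaussianReal_map_const_add, zero_add] at h
    exact h
  have : ∀ i : Fin N, SigmaFinite ((gaussianReal 0 (σ ^ 2).toNNReal).withDensity
      fun x => ENNReal.ofReal (Real.exp ((u i * x - u i * u i / 2) / σ ^ 2))) := fun i => by
    rw [← gaussianReal_eq_withDensity_gaussianReal_zero _ hσ]
    infer_instance
  rw [h1, funext fun i => gaussianReal_eq_withDensity_gaussianReal_zero (u i) hσ,
    pi_withDensity_eq _ fun i => by fun_prop]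
  congr 1
  ext n
  rw [← ENNReal.ofReal_prod_of_nonneg fun i _ => (Real.exp_pos _).le, ← Real.exp_sum, ssnmRatio,
    ← Finset.sum_div, Finset.sum_sub_distrib, ← Finset.sum_div]
  rfl

lemma integral_add_ssnmNoise {N : ℕ} {σ : ℝ} (hσ : 0 < σ) (u : Fin N → ℝ)
    (f : (Fin N → ℝ) → ℝ) :
    ∫ n, f (u + n) ∂ssnmNoise N σ = ∫ n, ssnmRatio σ u n * f n ∂ssnmNoise N σ := by
  have h := integral_map_equiv (μ := ssnmNoise N σ) (MeasurableEquiv.addLeft u) f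
  rw [MeasurableEquiv.coe_addLeft, map_add_ssnmNoise hσ,
    integral_withDensity_eq_integral_toReal_smul (measurable_ssnmRatio σ u).ennreal_ofReal
      (.of_forall fun _ => ENNReal.ofReal_lt_top)] at h
  rw [← h]
  simp [ENNReal.toReal_ofReal, (Real.exp_pos _).le, ssnmRatio]

lemma integral_ssnmRatio {N : ℕ} {σ : ℝ} (hσ : 0 < σ) (u : Fin N → ℝ) :
    ∫ n, ssnmRatio σ u n ∂ssnmNoise N σ = 1 := by
  simpa using (integral_add_ssnmNoise hσ u fun _ => 1).symm

lemma ssnmRatio_mul {N : ℕ} (σ : ℝ) (u v n : Fin N → ℝ) :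
    ssnmRatio σ u n * ssnmRatio σ v n
      = Real.exp (u ⬝ᵥ v / σ ^ 2) * ssnmRatio σ (u + v) n := by
  rw [ssnmRatio, ssnmRatio, ssnmRatio, ← Real.exp_add, ← Real.exp_add]
  congr 1
  simp only [add_dotProduct, dotProduct_add, dotProduct_comm v u]
  ring

lemma memLp_ssnmRatio {N : ℕ} {σ : ℝ} (hσ : 0 < σ) (u : Fin N → ℝ) :
    MemLp (ssnmRatio σ u) 2 (ssnmNoise N σ) := by
  rw [memLp_two_iff_integrable_sq (measurable_ssnmRatio σ u).aestronglyMeasurable]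
  simp_rw [sq, ssnmRatio_mul]
  refine Integrable.const_mul (Integrable.of_integral_ne_zero ?_) _
  simp [integral_ssnmRatio hσ]

lemma integral_ssnmRatio_mul {N : ℕ} {σ : ℝ} (hσ : 0 < σ) (u v : Fin N → ℝ) :
    ∫ n, ssnmRatio σ u n * ssnmRatio σ v n ∂ssnmNoise N σ = Real.exp (u ⬝ᵥ v / σ ^ 2) := by
  simp_rw [ssnmRatio_mul, integral_const_mul, integral_ssnmRatio hσ, mul_one]

lemma integral_ssnmRatio_sub_mul {N : ℕ} {σ : ℝ} (hσ : 0 < σ) (a u v : Fin N → ℝ)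
    (hu : a ⬝ᵥ u = 0) (hv : a ⬝ᵥ v = 0) :
    ∫ n, (ssnmRatio σ (a + u) n - ssnmRatio σ a n) * (ssnmRatio σ (a + v) n - ssnmRatio σ a n)
      ∂ssnmNoise N σ
      = Real.exp (a ⬝ᵥ a / σ ^ 2) * (Real.exp (u ⬝ᵥ v / σ ^ 2) - 1) := by
  have hi (p q : Fin N → ℝ) :
      Integrable (fun n => ssnmRatio σ p n * ssnmRatio σ q n) (ssnmNoise N σ) :=
    (memLp_ssnmRatio hσ p).integrable_mul (memLp_ssnmRatio hσ q)
  have hi' (p q r : Fin N → ℝ) : Integrable (fun n => ssnmRatio σ p n * ssnmRatio σ q n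
      - ssnmRatio σ p n * ssnmRatio σ r n) (ssnmNoise N σ) := (hi p q).sub (hi p r)
  have hexp (n : Fin N → ℝ) :
      (ssnmRatio σ (a + u) n - ssnmRatio σ a n) * (ssnmRatio σ (a + v) n - ssnmRatio σ a n)
        = ssnmRatio σ (a + u) n * ssnmRatio σ (a + v) n - ssnmRatio σ (a + u) n * ssnmRatio σ a n
          - (ssnmRatio σ a n * ssnmRatio σ (a + v) n - ssnmRatio σ a n * ssnmRatio σ a n) := by
    ring
  simp_rw [hexp]
  rw [integral_sub (hi' _ _ _) (hi' _ _ _), integral_sub (hi _ _) (hi _ _),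
    integral_sub (hi _ _) (hi _ _)]
  simp_rw [integral_ssnmRatio_mul hσ, add_dotProduct, dotProduct_add, dotProduct_comm u a, hu, hv]
  rw [mul_sub, ← Real.exp_add]
  ring_nf

/-- The Cauchy–Schwarz inequality in its linear form with a free parameter. -/
lemma two_mul_integral_mul_sub_le {Ω : Type*} [MeasurableSpace Ω] {μ : Measure Ω} {h F : Ω → ℝ}
    (hh : MemLp h 2 μ) (hF : MemLp F 2 μ) (c : ℝ) :
    2 * c * ∫ ω, h ω * F ω ∂μ - c ^ 2 * ∫ ω, F ω ^ 2 ∂μ ≤ ∫ ω, h ω ^ 2 ∂μ := by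
  have hhF : Integrable (fun ω => h ω * F ω) μ := hh.integrable_mul hF
  rw [← integral_const_mul, ← integral_const_mul,
    ← integral_sub (hhF.const_mul _) (hF.integrable_sq.const_mul _)]
  refine integral_mono ((hhF.const_mul _).sub (hF.integrable_sq.const_mul _)) hh.integrable_sq
    fun ω => ?_
  dsimp only
  nlinarith [sq_nonneg (h ω - c * F ω)]

lemma ssnmMean_eq_integral_noise {N : ℕ} (σ : ℝ) (g : (Fin N → ℝ) → ℝ) (x : Fin N → ℝ) :
    ssnmMean σ g x = ∫ n, g (x + n) ∂ssnmNoise N σ :=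
  integral_map_equiv (MeasurableEquiv.addLeft x) g

lemma ssnmVar_eq_integral_noise {N : ℕ} (σ : ℝ) (g : (Fin N → ℝ) → ℝ) (x : Fin N → ℝ) :
    ssnmVar σ g x = ∫ n, (g (x + n) - ssnmMean σ g x) ^ 2 ∂ssnmNoise N σ :=
  integral_map_equiv (MeasurableEquiv.addLeft x) fun y => (g y - ssnmMean σ g x) ^ 2

/-- A Hammersley–Chapman–Robbins type inequality for the finite differences of the mean at
`x + a` in coordinate directions orthogonal to `a`. -/
lemma ssnmVar_ge_finite_difference {N : ℕ} {σ : ℝ} (hσ : 0 < σ) {g : (Fin N → ℝ) → ℝ}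
    (hg : Measurable g) {x : Fin N → ℝ} (hsq : Integrable (fun y => g y ^ 2) (ssnmP σ x))
    (K : Finset (Fin N)) {a : Fin N → ℝ} (ha : ∀ l ∈ K, a l = 0) (b : Fin N → ℝ) (c t : ℝ) :
    2 * c * ∑ l ∈ K, b l * (ssnmMean σ g (x + a + t • Pi.single l 1) - ssnmMean σ g (x + a))
      - c ^ 2 * (Real.exp (a ⬝ᵥ a / σ ^ 2) * (Real.exp (t ^ 2 / σ ^ 2) - 1) * ∑ l ∈ K, b l ^ 2)
      ≤ ssnmVar σ g x := by
  have hgL : MemLp (fun n => g (x + n)) 2 (ssnmNoise N σ) := by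
    refine (memLp_two_iff_integrable_sq
      (hg.comp (measurable_const_add x)).aestronglyMeasurable).2 ?_
    exact (integrable_map_equiv (MeasurableEquiv.addLeft x) fun y => g y ^ 2).1 hsq
  have hh : MemLp (fun n => g (x + n) - ssnmMean σ g x) 2 (ssnmNoise N σ) :=
    hgL.sub (memLp_const _)
  set d : Fin N → (Fin N → ℝ) → ℝ := fun l n =>
    ssnmRatio σ (a + t • Pi.single l 1) n - ssnmRatio σ a n with hd
  have hdL (l : Fin N) : MemLp (d l) 2 (ssnmNoise N σ) :=
    (memLp_ssnmRatio hσ _).sub (memLp_ssnmRatio hσ _)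
  have hF : MemLp (fun n => ∑ l ∈ K, b l * d l n) 2 (ssnmNoise N σ) :=
    memLp_finsetSum K fun l _ => (hdL l).const_mul (b l)
  have hmul (l : Fin N) : ∫ n, (g (x + n) - ssnmMean σ g x) * d l n ∂ssnmNoise N σ
      = ssnmMean σ g (x + a + t • Pi.single l 1) - ssnmMean σ g (x + a) := by
    have hi (u : Fin N → ℝ) : Integrable
        (fun n => ssnmRatio σ u n * (g (x + n) - ssnmMean σ g x)) (ssnmNoise N σ) :=
      (memLp_ssnmRatio hσ u).integrable_mul hh
    have hm (u : Fin N → ℝ) : ∫ n, ssnmRatio σ u n * (g (x + n) - ssnmMean σ g x) ∂ssnmNoise N σ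
        = ssnmMean σ g (x + u) - ssnmMean σ g x := by
      have hiu : Integrable (fun n => ssnmRatio σ u n * g (x + n)) (ssnmNoise N σ) :=
        (memLp_ssnmRatio hσ u).integrable_mul hgL
      simp_rw [mul_sub]
      rw [integral_sub hiu (((memLp_ssnmRatio hσ u).integrable one_le_two).mul_const _),
        integral_mul_const, integral_ssnmRatio hσ, one_mul, ssnmMean_eq_integral_noise σ g (x + u),
        ← integral_add_ssnmNoise hσ u fun n => g (x + n)]
      simp_rw [add_assoc]
    calc _ = ∫ n, ssnmRatio σ (a + t • Pi.single l 1) n * (g (x + n) - ssnmMean σ g x)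
          - ssnmRatio σ a n * (g (x + n) - ssnmMean σ g x) ∂ssnmNoise N σ := by
            congr 1 with n
            simp only [hd]
            ring
      _ = _ := by
        rw [integral_sub (hi _) (hi _), hm, hm, add_assoc]
        ring
  have hdd (l m : Fin N) (hl : l ∈ K) (hm : m ∈ K) :
      ∫ n, d l n * d m n ∂ssnmNoise N σ = if l = m then
        Real.exp (a ⬝ᵥ a / σ ^ 2) * (Real.exp (t ^ 2 / σ ^ 2) - 1) else 0 := by
    have h := integral_ssnmRatio_sub_mul hσ a (t • Pi.single l 1) (t • Pi.single m 1)
      (by simp [ha l hl]) (by simp [ha m hm])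
    refine h.trans ?_
    split_ifs with hlm
    · subst hlm
      simp [sq]
    · simp [hlm]
  have key := two_mul_integral_mul_sub_le hh hF c
  have h1 : ∫ n, (g (x + n) - ssnmMean σ g x) * ∑ l ∈ K, b l * d l n ∂ssnmNoise N σ
      = ∑ l ∈ K, b l * (ssnmMean σ g (x + a + t • Pi.single l 1) - ssnmMean σ g (x + a)) := by
    have hi (l : Fin N) : Integrable
        (fun n => b l * ((g (x + n) - ssnmMean σ g x) * d l n)) (ssnmNoise N σ) :=
      (hh.integrable_mul (hdL l)).const_mul (b l)
    simp_rw [Finset.mul_sum, mul_left_comm _ (b _)]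
    rw [integral_finsetSum K fun l _ => hi l]
    simp_rw [integral_const_mul, hmul]
  have h2 : ∫ n, (∑ l ∈ K, b l * d l n) ^ 2 ∂ssnmNoise N σ
      = Real.exp (a ⬝ᵥ a / σ ^ 2) * (Real.exp (t ^ 2 / σ ^ 2) - 1) * ∑ l ∈ K, b l ^ 2 := by
    have hi (l m : Fin N) :
        Integrable (fun n => b l * b m * (d l n * d m n)) (ssnmNoise N σ) :=
      ((hdL l).integrable_mul (hdL m)).const_mul _
    simp_rw [sq (∑ l ∈ K, b l * d l _), Finset.sum_mul_sum, mul_mul_mul_comm (b _)]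
    rw [integral_finsetSum K fun l _ => integrable_finsetSum K fun m _ => hi l m, Finset.mul_sum]
    refine Finset.sum_congr rfl fun l hl => ?_
    rw [integral_finsetSum K fun m _ => hi l m, Finset.sum_eq_single_of_mem l hl]
    · rw [integral_const_mul, hdd l l hl hl, if_pos rfl]
      ring
    · intro m hm hml
      rw [integral_const_mul, hdd l m hl hm, if_neg hml.symm, mul_zero]
  rw [h1, h2, ← ssnmVar_eq_integral_noise] at key
  exact key

/-- Modified CRB-type bound for the SSNM. With `x₀^K` the vector
obtained from `x₀` by zeroing all entries outside `K`, and `b_l` the partial derivatives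
of the mean function at `x₀^K` along `e_l`, `l ∈ K`,
`v(ĝ;x₀) ≥ exp(−(1/σ²) Σ_{l∈supp(x₀)∖K} (x₀)_l²) · σ² Σ_{l∈K} b_l²`.
(Note `Σ_{l∈supp(x₀)∖K} (x₀)_l² = Σ_{l∉K} (x₀)_l²`, since `x₀` vanishes off its
support.) -/
theorem ssnm_modified_crb_type_bound {N S : ℕ} (hN : 1 ≤ N) (hS1 : 1 ≤ S) (hSN : S ≤ N)
    (σ : ℝ) (hσ : 0 < σ)
    (x₀ : Fin N → ℝ) (hx₀ : x₀ ∈ sparseSet N S)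
    (K : Finset (Fin N)) (hKne : K.Nonempty) (hKS : K.card ≤ S)
    (g : (Fin N → ℝ) → ℝ) (hg : Measurable g)
    (hint : ∀ x ∈ sparseSet N S, Integrable g (ssnmP σ x))
    (hsq : Integrable (fun y => g y ^ 2) (ssnmP σ x₀))
    (b : Fin N → ℝ)
    (hder : ∀ l ∈ K, HasDerivAt
      (fun t : ℝ => ssnmMean σ g
        ((fun i => if i ∈ K then x₀ i else 0) + t • (Pi.single l (1:ℝ) : Fin N → ℝ)))
      (b l) 0) :
    Real.exp (-(1 / σ ^ 2) * ∑ l ∈ Kᶜ, x₀ l ^ 2) * (σ ^ 2 * ∑ l ∈ K, b l ^ 2)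
      ≤ ssnmVar σ g x₀ := by
  set a : Fin N → ℝ := fun i => if i ∈ K then 0 else -x₀ i with ha
  have hxa : (fun i => if i ∈ K then x₀ i else 0) = x₀ + a := by
    ext i
    by_cases hi : i ∈ K <;> simp [ha, hi]
  have haa : a ⬝ᵥ a = ∑ l ∈ Kᶜ, x₀ l ^ 2 := by
    have hsub : ∑ l ∈ K, a l * a l = 0 := Finset.sum_eq_zero fun l hl => by simp [ha, hl]
    rw [dotProduct, ← Finset.sum_add_sum_compl K, hsub, zero_add]
    refine Finset.sum_congr rfl fun l hl => ?_
    simp [ha, Finset.mem_compl.1 hl, sq]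
  rw [hxa] at hder
  rw [← haa]
  set B := ∑ l ∈ K, b l ^ 2 with hB
  have hB0 : 0 ≤ B := Finset.sum_nonneg fun l _ => sq_nonneg _
  set W := Real.exp (a ⬝ᵥ a / σ ^ 2) with hW
  have hW0 : 0 < W := Real.exp_pos _
  have hWinv : Real.exp (-(1 / σ ^ 2) * a ⬝ᵥ a) = W⁻¹ := by
    rw [hW, ← Real.exp_neg]
    ring_nf
  rw [hWinv]
  have hderiv : HasDerivAt (fun t : ℝ => ∑ l ∈ K, b l *
      ssnmMean σ g (x₀ + a + t • (Pi.single l (1 : ℝ) : Fin N → ℝ))) B 0 := by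
    simp_rw [hB, sq]
    exact HasDerivAt.fun_sum fun l hl => (hder l hl).const_mul (b l)
  set c := σ ^ 2 * W⁻¹ with hc
  have hlim := ((hasDerivAt_iff_tendsto_slope_zero.1 hderiv).const_mul (2 * c)).sub
    ((Continuous.tendsto
      (f := fun t : ℝ => c ^ 2 * (W * (1 / σ ^ 2 * Real.exp (t ^ 2 / σ ^ 2)) * B))
      (by fun_prop) 0).mono_left (nhdsWithin_le_nhds (s := {0}ᶜ)))
  have hval : 2 * c * B - c ^ 2 * (W * (1 / σ ^ 2 * Real.exp ((0 : ℝ) ^ 2 / σ ^ 2)) * B)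
      = W⁻¹ * (σ ^ 2 * B) := by
    rw [hc]
    simp
    field_simp
    ring
  rw [hval] at hlim
  refine le_of_tendsto hlim ?_
  filter_upwards [self_mem_nhdsWithin] with t ht
  have ht0 : t ≠ 0 := ht
  have hexp : Real.exp (t ^ 2 / σ ^ 2) - 1 ≤ t ^ 2 / σ ^ 2 * Real.exp (t ^ 2 / σ ^ 2) := by
    have h := mul_le_mul_of_nonneg_right (Real.add_one_le_exp (-(t ^ 2 / σ ^ 2)))
      (Real.exp_pos (t ^ 2 / σ ^ 2)).le
    rw [← Real.exp_add, neg_add_cancel, Real.exp_zero] at h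
    linarith
  refine le_trans ?_ (ssnmVar_ge_finite_difference hσ hg hsq K (a := a)
    (fun l hl => by simp [ha, hl]) b (c / t) t)
  refine sub_le_sub (le_of_eq ?_) ?_
  · simp only [zero_add, zero_smul, add_zero, smul_eq_mul, mul_sub, Finset.sum_sub_distrib]
    ring
  · calc _ ≤ (c / t) ^ 2 * (W * (t ^ 2 / σ ^ 2 * Real.exp (t ^ 2 / σ ^ 2)) * B) := by gcongr
      _ = _ := by field_simp
end

section
/- (HCRB for the SSNM, low-sparsity case.) Consider the SSNM. Let k ∈ {1,…,N} and x₀ ∈ X_S with |supp(x₀) ∪ {k}| ≤ S. Let ĝ : ℝ^N → ℝ be Borel measurable with ∫ ĝ² dP_{x₀} < ∞, and suppose ĝ is an unbiased estimator of x_k on X_S, i.e., ĝ is P_x-integrable with ∫ ĝ dP_x = x_k for every x ∈ X_S. Then v(ĝ; x₀) ≥ σ². -/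
open MeasureTheory ProbabilityTheory

/-- Reweighting one factor of a product of probability measures by a density reweights the product
by that density evaluated at the corresponding coordinate. -/
theorem pi_update_withDensity {ι : Type*} [Fintype ι] [DecidableEq ι] {α : Type*}
    [MeasurableSpace α] (μ : ι → Measure α) [∀ i, IsProbabilityMeasure (μ i)] (k : ι)
    {L : α → ENNReal} (hL : Measurable L) (ν : ι → Measure α) [∀ i, IsProbabilityMeasure (ν i)]
    (hk : ν k = (μ k).withDensity L) (hne : ∀ i, i ≠ k → ν i = μ i) :
    Measure.pi ν = (Measure.pi μ).withDensity fun y => L (y k) := by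
  refine Measure.pi_eq fun s hs => ?_
  have hm : MeasurableSet (Set.univ.pi s) := MeasurableSet.univ_pi hs
  let f : ι → α → ENNReal := fun i => (s i).indicator (if i = k then L else 1)
  have hf : ∀ i, Measurable (f i) := fun i => by
    refine Measurable.indicator ?_ (hs i)
    split_ifs
    · exact hL
    · exact measurable_one
  have hind : iIndepFun (fun i (y : ι → α) => f i (y i)) (Measure.pi μ) :=
    iIndepFun_pi (fun i => (hf i).aemeasurable)
  have hprod : ∀ y : ι → α,
      (Set.univ.pi s).indicator (fun y => L (y k)) y = ∏ i, f i (y i) := fun y => by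
    by_cases hy : y ∈ Set.univ.pi s
    · have hy' : ∀ i, y i ∈ s i := fun i => hy i (Set.mem_univ i)
      rw [Set.indicator_of_mem hy, Finset.prod_eq_single k]
      · simp [f, hy']
      · intro i _ hi
        simp [f, hy', hi]
      · simp
    · rw [Set.indicator_of_notMem hy]
      simp only [Set.mem_pi, Set.mem_univ, true_imp_iff, not_forall] at hy
      obtain ⟨i, hi⟩ := hy
      exact (Finset.prod_eq_zero (Finset.mem_univ i) (by simp [f, hi])).symm
  rw [withDensity_apply _ hm, ← lintegral_indicator hm]
  simp_rw [hprod]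
  rw [lintegral_prod_eq_prod_lintegral_of_indepFun Finset.univ _ hind
    (fun i => (hf i).comp (measurable_pi_apply i))]
  refine Finset.prod_congr rfl fun i _ => ?_
  rw [(measurePreserving_eval μ i).lintegral_comp (hf i)]
  simp only [f]
  rw [lintegral_indicator (hs i)]
  by_cases hi : i = k
  · subst hi
    simp [hk, withDensity_apply _ (hs i)]
  · simp [hi, hne i hi]

/-- The likelihood ratio of `N(m + v s, v)` with respect to `N(m, v)`. -/
noncomputable def gaussianShiftRatio (m : ℝ) (v : NNReal) (s y : ℝ) : ℝ :=
  Real.exp (s * y) * Real.exp (-(s * m + v * s ^ 2 / 2))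

theorem measurable_gaussianShiftRatio (m : ℝ) (v : NNReal) (s : ℝ) :
    Measurable (gaussianShiftRatio m v s) := by
  unfold gaussianShiftRatio
  fun_prop

theorem gaussianShiftRatio_nonneg (m : ℝ) (v : NNReal) (s y : ℝ) :
    0 ≤ gaussianShiftRatio m v s y := by
  unfold gaussianShiftRatio
  positivity

theorem gaussianReal_add_mul_eq_withDensity (m : ℝ) {v : NNReal} (hv : v ≠ 0) (s : ℝ) :
    gaussianReal (m + v * s) v =
      (gaussianReal m v).withDensity fun y => ENNReal.ofReal (gaussianShiftRatio m v s y) := by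
  have hv' : (v : ℝ) ≠ 0 := by exact_mod_cast hv
  rw [gaussianReal_of_var_ne_zero _ hv, gaussianReal_of_var_ne_zero _ hv,
    ← withDensity_mul _ (measurable_gaussianPDF m v)
      (measurable_gaussianShiftRatio m v s).ennreal_ofReal]
  congr 1
  ext y
  rw [Pi.mul_apply, gaussianPDF, gaussianPDF,
    ← ENNReal.ofReal_mul (gaussianPDFReal_nonneg m v y)]
  congr 1
  rw [gaussianPDFReal, gaussianPDFReal, gaussianShiftRatio, ← Real.exp_add, mul_assoc _ (Real.exp _),
    ← Real.exp_add]
  congr 2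
  field_simp
  ring

theorem integrable_gaussianShiftRatio (m : ℝ) (v : NNReal) (s : ℝ) :
    Integrable (gaussianShiftRatio m v s) (gaussianReal m v) :=
  (integrable_exp_mul_gaussianReal s).mul_const _

theorem integral_exp_mul_gaussianReal (m : ℝ) (v : NNReal) (s : ℝ) :
    ∫ y, Real.exp (s * y) ∂gaussianReal m v = Real.exp (m * s + v * s ^ 2 / 2) :=
  congrFun (mgf_id_gaussianReal (μ := m) (v := v)) s

theorem integral_gaussianShiftRatio (m : ℝ) (v : NNReal) (s : ℝ) :
    ∫ y, gaussianShiftRatio m v s y ∂gaussianReal m v = 1 := by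
  unfold gaussianShiftRatio
  rw [integral_mul_const, integral_exp_mul_gaussianReal, ← Real.exp_add, ← Real.exp_zero]
  congr 1
  ring

theorem gaussianShiftRatio_sq (m : ℝ) (v : NNReal) (s y : ℝ) :
    gaussianShiftRatio m v s y ^ 2 =
      Real.exp (v * s ^ 2) * gaussianShiftRatio m v (2 * s) y := by
  simp only [gaussianShiftRatio, ← Real.exp_add, ← Real.exp_nat_mul]
  congr 1
  push_cast
  ring

/-- Translating the mean vector of the model amounts to using independent Gaussian coordinates with
the given means. -/
theorem ssnmP_eq_pi {N : ℕ} (σ : ℝ) (x : Fin N → ℝ) :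
    ssnmP σ x = Measure.pi fun i => gaussianReal (x i) ((σ ^ 2).toNNReal) := by
  have h := Measure.pi_map_pi (μ := fun _ : Fin N => gaussianReal 0 ((σ ^ 2).toNNReal))
    (f := fun i y => x i + y) (fun i => by fun_prop)
  simp only [gaussianReal_map_const_add, zero_add] at h
  exact h

/-- The Hammersley–Chapman–Robbins inequality, in squared form. -/
theorem sq_integral_mul_sub_integral_le {Ω : Type*} [MeasurableSpace Ω] {μ : Measure Ω}
    [IsProbabilityMeasure μ] {g L : Ω → ℝ} (hg : MemLp g 2 μ) (hL : MemLp L 2 μ)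
    (hL1 : ∫ y, L y ∂μ = 1) :
    (∫ y, L y * g y ∂μ - ∫ y, g y ∂μ) ^ 2 ≤
      (∫ y, (g y - ∫ z, g z ∂μ) ^ 2 ∂μ) * (∫ y, L y ^ 2 ∂μ - 1) := by
  set a := ∫ y, g y ∂μ with ha
  have hgi := hg.integrable one_le_two
  have hLi := hL.integrable one_le_two
  have hf : MemLp (fun y => g y - a) 2 μ := hg.sub (memLp_const a)
  have hh : MemLp (fun y => L y - 1) 2 μ := hL.sub (memLp_const 1)
  have hfh : Integrable (fun y => (g y - a) * (L y - 1)) μ := hf.integrable_mul hh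
  have hLg : Integrable (fun y => L y * g y) μ := hL.integrable_mul hg
  have haff : ∀ b c : ℝ, Integrable (fun y => b * L y - c) μ := fun b c =>
    (hLi.const_mul b).sub (integrable_const c)
  have hcov : ∫ y, (g y - a) * (L y - 1) ∂μ = ∫ y, L y * g y ∂μ - a := by
    have : ∀ y, (g y - a) * (L y - 1) = (L y * g y - g y) - (a * L y - a) := fun y => by ring
    simp_rw [this]
    rw [integral_sub (f := fun y => L y * g y - g y) (hLg.sub hgi) (haff a a),
      integral_sub hLg hgi, integral_sub (hLi.const_mul a) (integrable_const a),
      integral_const_mul, hL1, ← ha]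
    simp
  have hvar : ∫ y, (L y - 1) ^ 2 ∂μ = ∫ y, L y ^ 2 ∂μ - 1 := by
    have : ∀ y, (L y - 1) ^ 2 = L y ^ 2 - (2 * L y - 1) := fun y => by ring
    simp_rw [this]
    rw [integral_sub hL.integrable_sq (haff 2 1),
      integral_sub (hLi.const_mul 2) (integrable_const 1), integral_const_mul, hL1]
    norm_num
  rw [← hcov, ← hvar]
  have hquad : ∀ c : ℝ, 0 ≤ (∫ y, (L y - 1) ^ 2 ∂μ) * (c * c)
      + (-2 * ∫ y, (g y - a) * (L y - 1) ∂μ) * c + ∫ y, (g y - a) ^ 2 ∂μ := fun c => by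
    have h0 : 0 ≤ ∫ y, ((g y - a) - c * (L y - 1)) ^ 2 ∂μ :=
      integral_nonneg fun y => sq_nonneg _
    have : ∀ y, ((g y - a) - c * (L y - 1)) ^ 2 =
        (g y - a) ^ 2 - (2 * c * ((g y - a) * (L y - 1)) - c * c * (L y - 1) ^ 2) :=
      fun y => by ring
    simp_rw [this] at h0
    have hcross : Integrable
        (fun y => 2 * c * ((g y - a) * (L y - 1)) - c * c * (L y - 1) ^ 2) μ :=
      (hfh.const_mul (2 * c)).sub (hh.integrable_sq.const_mul (c * c))
    rw [integral_sub hf.integrable_sq hcross,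
      integral_sub (hfh.const_mul (2 * c)) (hh.integrable_sq.const_mul (c * c)),
      integral_const_mul, integral_const_mul] at h0
    linarith
  have hd := discrim_le_zero hquad
  rw [discrim] at hd
  nlinarith

theorem exp_sub_one_mul_one_sub_le {s : ℝ} : (Real.exp s - 1) * (1 - s) ≤ s := by
  have h : Real.exp s * (1 - s) ≤ 1 := by
    have := mul_le_mul_of_nonneg_left (Real.one_sub_le_exp_neg s) (Real.exp_pos s).le
    rwa [← Real.exp_add, add_neg_cancel, Real.exp_zero] at this
  linarith

/-- The variance bound obtained from a shift of the `k`-th coordinate by `σ² s`. -/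
theorem ssnm_shift_bound {N : ℕ} {σ : ℝ} (hσ : 0 < σ) (k : Fin N) (x₀ : Fin N → ℝ) (s : ℝ)
    {g : (Fin N → ℝ) → ℝ} (hg : MemLp g 2 (ssnmP σ x₀)) :
    (ssnmMean σ g (Function.update x₀ k (x₀ k + σ ^ 2 * s)) - ssnmMean σ g x₀) ^ 2 ≤
      ssnmVar σ g x₀ * (Real.exp (σ ^ 2 * s ^ 2) - 1) := by
  set v : NNReal := (σ ^ 2).toNNReal with hvdef
  have hvr : (v : ℝ) = σ ^ 2 := Real.coe_toNNReal _ (by positivity)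
  have hv : v ≠ 0 := by
    have : (v : ℝ) ≠ 0 := by rw [hvr]; positivity
    exact_mod_cast this
  let ℓ := gaussianShiftRatio (x₀ k) v s
  have hℓ : Measurable ℓ := measurable_gaussianShiftRatio _ _ _
  have hshift : ssnmP σ (Function.update x₀ k (x₀ k + σ ^ 2 * s)) =
      (ssnmP σ x₀).withDensity fun y => ENNReal.ofReal (ℓ (y k)) := by
    rw [ssnmP_eq_pi, ssnmP_eq_pi]
    refine pi_update_withDensity _ k hℓ.ennreal_ofReal _ ?_ fun i hi => by simp [hi]
    rw [Function.update_self, ← hvdef, ← hvr]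
    exact gaussianReal_add_mul_eq_withDensity _ hv s
  have hprob : IsProbabilityMeasure (ssnmP σ x₀) := by
    rw [ssnmP_eq_pi]
    infer_instance
  have heval : MeasurePreserving (Function.eval k) (ssnmP σ x₀) (gaussianReal (x₀ k) v) := by
    rw [ssnmP_eq_pi]
    exact measurePreserving_eval (fun i => gaussianReal (x₀ i) v) k
  have hint : ∀ f : ℝ → ℝ, Measurable f →
      ∫ y, f (y k) ∂ssnmP σ x₀ = ∫ z, f z ∂gaussianReal (x₀ k) v := fun f hf => by
    rw [← heval.map_eq, integral_map heval.aemeasurable hf.aestronglyMeasurable]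
  have hsq : (fun z => ℓ z ^ 2) = fun z =>
      Real.exp (v * s ^ 2) * gaussianShiftRatio (x₀ k) v (2 * s) z :=
    funext fun z => gaussianShiftRatio_sq _ _ _ _
  have hℓ2 : Integrable (fun z => ℓ z ^ 2) (gaussianReal (x₀ k) v) := by
    rw [hsq]
    exact (integrable_gaussianShiftRatio _ _ _).const_mul _
  have hL : MemLp (fun y : Fin N → ℝ => ℓ (y k)) 2 (ssnmP σ x₀) :=
    ((memLp_two_iff_integrable_sq hℓ.aestronglyMeasurable).2 hℓ2).comp_measurePreserving heval
  have hmean : ssnmMean σ g (Function.update x₀ k (x₀ k + σ ^ 2 * s)) =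
      ∫ y, ℓ (y k) * g y ∂ssnmP σ x₀ := by
    rw [ssnmMean, hshift, integral_withDensity_eq_integral_toReal_smul
      (by fun_prop) (by simp)]
    refine integral_congr_ae (.of_forall fun y => ?_)
    simp [ENNReal.toReal_ofReal (gaussianShiftRatio_nonneg _ _ _ _), ℓ]
  have hL2 : ∫ y, ℓ (y k) ^ 2 ∂ssnmP σ x₀ = Real.exp (σ ^ 2 * s ^ 2) := by
    rw [hint (fun z => ℓ z ^ 2) (hℓ.pow_const 2), hsq, integral_const_mul,
      integral_gaussianShiftRatio, mul_one, hvr]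
  have h := sq_integral_mul_sub_integral_le hg hL
    ((hint ℓ hℓ).trans (integral_gaussianShiftRatio _ _ _))
  rwa [hL2, ← hmean] at h

/-- HCRB for the SSNM, low-sparsity case. If
`|supp(x₀) ∪ {k}| ≤ S` and `ĝ` is a finite-variance unbiased estimator of `x_k` on
`X_S`, then `v(ĝ;x₀) ≥ σ²`. -/
theorem ssnm_hcrb_low {N S : ℕ} (hN : 1 ≤ N) (hS1 : 1 ≤ S) (hSN : S ≤ N)
    (σ : ℝ) (hσ : 0 < σ) (k : Fin N)
    (x₀ : Fin N → ℝ) (hx₀ : x₀ ∈ sparseSet N S)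
    (hcase : (Function.support x₀ ∪ {k}).ncard ≤ S)
    (g : (Fin N → ℝ) → ℝ) (hg : Measurable g)
    (hsq : Integrable (fun y => g y ^ 2) (ssnmP σ x₀))
    (hunb : ∀ x ∈ sparseSet N S,
      Integrable g (ssnmP σ x) ∧ (∫ y, g y ∂ ssnmP σ x) = x k) :
    σ ^ 2 ≤ ssnmVar σ g x₀ := by
  have hmem : MemLp g 2 (ssnmP σ x₀) :=
    (memLp_two_iff_integrable_sq hg.aestronglyMeasurable).2 hsq
  have hV0 : 0 ≤ ssnmVar σ g x₀ := integral_nonneg fun y => sq_nonneg _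
  have hbound : ∀ s : ℝ, (σ ^ 2 * s) ^ 2 ≤
      ssnmVar σ g x₀ * (Real.exp (σ ^ 2 * s ^ 2) - 1) := fun s => by
    have hmemS : Function.update x₀ k (x₀ k + σ ^ 2 * s) ∈ sparseSet N S := by
      refine (Set.ncard_le_ncard (fun i hi => ?_) (Set.toFinite _)).trans hcase
      by_cases hik : i = k
      · exact Or.inr hik
      · exact Or.inl (by simpa [hik] using hi)
    have h := ssnm_shift_bound hσ k x₀ s hmem
    rw [ssnmMean, ssnmMean, (hunb _ hmemS).2, (hunb _ hx₀).2, Function.update_self,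
      add_sub_cancel_left] at h
    exact h
  by_contra! hlt
  have hσ2 : 0 < σ ^ 2 := by positivity
  set V := ssnmVar σ g x₀
  obtain ⟨u, hu⟩ : ∃ u, u = (1 - V / σ ^ 2) / 2 := ⟨_, rfl⟩
  have hu0 : 0 < u := by
    have := (div_lt_one hσ2).2 hlt
    rw [hu]
    linarith
  have hu1 : 0 < 1 - u := by
    have := div_nonneg hV0 hσ2.le
    rw [hu]
    linarith
  have hVu : V = σ ^ 2 * (1 - 2 * u) := by
    rw [hu]
    field_simp
    ring
  have h := hbound (Real.sqrt u / σ)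
  have h1 : (σ ^ 2 * (Real.sqrt u / σ)) ^ 2 = σ ^ 2 * u := by
    rw [mul_pow, div_pow, Real.sq_sqrt hu0.le]
    field_simp
  have h2 : σ ^ 2 * (Real.sqrt u / σ) ^ 2 = u := by
    rw [div_pow, Real.sq_sqrt hu0.le]
    field_simp
  rw [h1, h2] at h
  have h3 := mul_le_mul_of_nonneg_left (exp_sub_one_mul_one_sub_le (s := u)) hV0
  have h4 := mul_le_mul_of_nonneg_right h hu1.le
  have h5 : 0 < σ ^ 2 * u * u := by positivity
  rw [hVu] at h3 h4
  nlinarith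
end

section
/- (Exact versus approximate sparsity.) Fix integers N, M ≥ 1, a matrix H ∈ ℝ^{M×N} (no condition on H), and σ > 0. Let X ⊆ ℝ^N be a set containing a nonempty open subset of ℝ^N, let x₀ ∈ X, and let γ : ℝ^N → ℝ. Assume there exists a Borel function ĝ₀ : ℝ^M → ℝ with ∫ ĝ₀² dP_{x₀} < ∞ that is P_x-integrable with ∫ ĝ₀ dP_x = γ(x) for every x ∈ ℝ^N. Then inf { v(ĝ; x₀) : ĝ : ℝ^M → ℝ Borel, ∫ ĝ² dP_{x₀} < ∞, and ĝ is P_x-integrable with ∫ ĝ dP_x = γ(x) for every x ∈ X } = inf { v(ĝ; x₀) : ĝ : ℝ^M → ℝ Borel, ∫ ĝ² dP_{x₀} < ∞, and ĝ is P_x-integrable with ∫ ĝ dP_x = γ(x) for every x ∈ ℝ^N }. In words: prescribing the mean function only on a parameter set containing an open set yields the same minimum achievable variance at x₀ as prescribing it on all of ℝ^N. -/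
open Matrix MeasureTheory ProbabilityTheory

/-- The distribution `P_x` of `y = Hx + n` where `n` has i.i.d. `N(0,σ²)` entries. -/
noncomputable def slgmP {M N : ℕ} (H : Matrix (Fin M) (Fin N) ℝ) (σ : ℝ)
    (x : Fin N → ℝ) : Measure (Fin M → ℝ) :=
  Measure.map (fun n => H.mulVec x + n)
    (Measure.pi fun _ : Fin M => gaussianReal 0 ((σ ^ 2).toNNReal))

/-- Mean function `γ_ĝ(x) = ∫ ĝ dP_x` of an estimator. -/
noncomputable def slgmMean {M N : ℕ} (H : Matrix (Fin M) (Fin N) ℝ) (σ : ℝ)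
    (g : (Fin M → ℝ) → ℝ) (x : Fin N → ℝ) : ℝ := ∫ y, g y ∂ slgmP H σ x

/-- Variance `v(ĝ;x) = ∫ (ĝ(y) − γ_ĝ(x))² dP_x(y)` of an estimator. -/
noncomputable def slgmVar {M N : ℕ} (H : Matrix (Fin M) (Fin N) ℝ) (σ : ℝ)
    (g : (Fin M → ℝ) → ℝ) (x : Fin N → ℝ) : ℝ :=
  ∫ y, (g y - slgmMean H σ g x) ^ 2 ∂ slgmP H σ x

open Filter Topology
open scoped NNReal

/-- Exponentially tilting a Gaussian by a linear function shifts its mean. -/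
lemma gaussianReal_tilted_const_mul (m c : ℝ) {v : ℝ≥0} (hv : v ≠ 0) :
    (gaussianReal m v).tilted (fun y => c * y) = gaussianReal (m + v * c) v := by
  have hv' : (v : ℝ) ≠ 0 := by exact_mod_cast hv
  have hZ : ∫ y, Real.exp (c * y) ∂gaussianReal m v = Real.exp (m * c + v * c ^ 2 / 2) := by
    have := mgf_gaussianReal (p := gaussianReal m v) (X := id) Measure.map_id c
    simpa [mgf] using this
  rw [Measure.tilted, hZ, gaussianReal_of_var_ne_zero _ hv, gaussianReal_of_var_ne_zero _ hv,
    ← withDensity_mul _ (measurable_gaussianPDF _ _) (by fun_prop)]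
  congr 1
  ext y
  rw [Pi.mul_apply, gaussianPDF, gaussianPDF,
    ← ENNReal.ofReal_mul (gaussianPDFReal_nonneg _ _ _), gaussianPDFReal, gaussianPDFReal,
    ← Real.exp_sub, mul_assoc, ← Real.exp_add]
  congr 3
  field_simp
  ring

/-- Exponential tilting of a product measure by a sum of one-variable functions. -/
lemma pi_tilted_sum {ι : Type*} [Fintype ι] {α : ι → Type*} [∀ i, MeasurableSpace (α i)]
    (μ : ∀ i, Measure (α i)) [∀ i, SigmaFinite (μ i)] (f : ∀ i, α i → ℝ) :
    (Measure.pi μ).tilted (fun y => ∑ i, f i (y i)) =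
      Measure.pi fun i => (μ i).tilted (f i) := by
  refine (Measure.pi_eq fun s hs => ?_).symm
  rw [tilted_apply_eq_ofReal_integral' _ (.univ_pi hs)]
  simp_rw [Real.exp_sum, tilted_apply_eq_ofReal_integral' _ (hs _)]
  rw [integral_fintype_prod_eq_prod (fun i y => Real.exp (f i y)), Measure.restrict_pi_pi]
  simp_rw [← Finset.prod_div_distrib]
  rw [integral_fintype_prod_eq_prod
      (fun i y => Real.exp (f i y) / ∫ z, Real.exp (f i z) ∂μ i),
    ENNReal.ofReal_prod_of_nonneg fun i _ => integral_nonneg fun y => by positivity]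

lemma slgmP_eq_pi {M N : ℕ} (H : Matrix (Fin M) (Fin N) ℝ) (σ : ℝ) (x : Fin N → ℝ) :
    slgmP H σ x = Measure.pi fun i => gaussianReal (H.mulVec x i) (σ ^ 2).toNNReal := by
  have h := Measure.pi_map_pi (μ := fun _ : Fin M => gaussianReal 0 (σ ^ 2).toNNReal)
    (f := fun i y => H.mulVec x i + y) (fun i => by fun_prop)
  simp only [gaussianReal_map_const_add, zero_add] at h
  exact h

lemma slgmP_add {M N : ℕ} (H : Matrix (Fin M) (Fin N) ℝ) {σ : ℝ} (hσ : 0 < σ)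
    (x d : Fin N → ℝ) :
    slgmP H σ (x + d) =
      (slgmP H σ x).tilted fun y => ∑ i, H.mulVec d i / σ ^ 2 * y i := by
  have hv : (σ ^ 2).toNNReal ≠ 0 := by
    simpa using hσ.ne'
  rw [slgmP_eq_pi, slgmP_eq_pi, pi_tilted_sum _ fun i y => H.mulVec d i / σ ^ 2 * y]
  congr 1
  ext1 i
  rw [gaussianReal_tilted_const_mul _ _ hv, Real.coe_toNNReal _ (sq_nonneg σ),
    Matrix.mulVec_add, Pi.add_apply]
  congr 2
  field_simp

lemma integrable_exp_linear_slgmP {M N : ℕ} (H : Matrix (Fin M) (Fin N) ℝ) (σ : ℝ)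
    (x : Fin N → ℝ) (c : Fin M → ℝ) :
    Integrable (fun y => Real.exp (∑ i, c i * y i)) (slgmP H σ x) := by
  simp_rw [slgmP_eq_pi, Real.exp_sum]
  exact Integrable.fintype_prod_dep (f := fun i y => Real.exp (c i * y))
    fun i => integrable_exp_mul_gaussianReal _

/-- A function that is square integrable under one `P_x` is integrable under all of them. -/
lemma integrable_slgmP_of_integrable_sq {M N : ℕ} (H : Matrix (Fin M) (Fin N) ℝ) {σ : ℝ}
    (hσ : 0 < σ) (x₀ x : Fin N → ℝ) {f : (Fin M → ℝ) → ℝ} (hf : Measurable f)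
    (hf2 : Integrable (fun y => f y ^ 2) (slgmP H σ x₀)) :
    Integrable f (slgmP H σ x) := by
  obtain ⟨d, rfl⟩ : ∃ d, x = x₀ + d := ⟨x - x₀, by simp⟩
  rw [slgmP_add H hσ, integrable_tilted_iff (integrable_exp_linear_slgmP H σ x₀ _)]
  have h1 : MemLp f 2 (slgmP H σ x₀) :=
    (memLp_two_iff_integrable_sq hf.aestronglyMeasurable).2 hf2
  have h2 : MemLp (fun y : Fin M → ℝ => Real.exp (∑ i, H.mulVec d i / σ ^ 2 * y i)) 2
      (slgmP H σ x₀) := by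
    refine (memLp_two_iff_integrable_sq
      (integrable_exp_linear_slgmP H σ x₀ _).aestronglyMeasurable).2 ?_
    have := integrable_exp_linear_slgmP H σ x₀ fun i => 2 * (H.mulVec d i / σ ^ 2)
    refine this.congr (ae_of_all _ fun y => ?_)
    simp only [← Real.exp_nat_mul, Finset.mul_sum, Nat.cast_ofNat, mul_assoc]
  exact h2.integrable_mul h1

/-- A two-sided Laplace transform that vanishes near `0` vanishes identically. -/
lemma integral_exp_mul_eq_zero_of_eventually {Ω : Type*} [MeasurableSpace Ω] {μ : Measure Ω}
    {W f : Ω → ℝ} (hf : Measurable f)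
    (hint : ∀ t : ℝ, Integrable (fun ω => Real.exp (t * W ω) * f ω) μ)
    (h0 : ∀ᶠ t in 𝓝 (0 : ℝ), ∫ ω, Real.exp (t * W ω) * f ω ∂μ = 0) (t : ℝ) :
    ∫ ω, Real.exp (t * W ω) * f ω ∂μ = 0 := by
  have hpos : ∀ t : ℝ, Integrable (fun ω => max (f ω) 0 * Real.exp (t * W ω)) μ := fun t =>
    (hint t).pos_part.congr (ae_of_all _ fun ω => by
      simp only [mul_comm (max (f ω) 0), mul_max_of_nonneg _ _ (Real.exp_pos (t * W ω)).le,
        mul_zero])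
  have hneg : ∀ t : ℝ, Integrable (fun ω => max (-f ω) 0 * Real.exp (t * W ω)) μ := fun t =>
    (hint t).neg_part.congr (ae_of_all _ fun ω => by
      simp only [mul_comm (max (-f ω) 0), mul_max_of_nonneg _ _ (Real.exp_pos (t * W ω)).le,
        mul_zero, mul_neg])
  have hanalytic : ∀ {g : Ω → ℝ}, Measurable g →
      (∀ t : ℝ, Integrable (fun ω => max (g ω) 0 * Real.exp (t * W ω)) μ) →
      AnalyticOnNhd ℝ (mgf W (μ.withDensity fun ω => ENNReal.ofReal (g ω))) Set.univ := by
    intro g hg hgi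
    have : integrableExpSet W (μ.withDensity fun ω => ENNReal.ofReal (g ω)) = Set.univ := by
      refine Set.eq_univ_of_forall fun t => ?_
      refine (integrable_withDensity_iff_integrable_smul' (by fun_prop) (by simp)).2 ?_
      simpa only [ENNReal.toReal_ofReal', smul_eq_mul] using hgi t
    simpa [this] using analyticOnNhd_mgf (X := W)
      (μ := μ.withDensity fun ω => ENNReal.ofReal (g ω))
  have hsub : ∀ t : ℝ, ∫ ω, Real.exp (t * W ω) * f ω ∂μ =
      mgf W (μ.withDensity fun ω => ENNReal.ofReal (f ω)) t -
        mgf W (μ.withDensity fun ω => ENNReal.ofReal (-f ω)) t := by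
    intro t
    rw [mgf, mgf, integral_withDensity_eq_integral_toReal_smul (by fun_prop) (by simp),
      integral_withDensity_eq_integral_toReal_smul (by fun_prop) (by simp)]
    simp only [ENNReal.toReal_ofReal', smul_eq_mul]
    rw [← integral_sub (hpos t) (hneg t)]
    congr 1
    ext ω
    rw [← sub_mul, max_zero_sub_max_neg_zero_eq_self, mul_comm]
  rw [hsub, sub_eq_zero]
  exact congrFun (AnalyticOnNhd.eq_of_eventuallyEq (hanalytic hf hpos) (hanalytic hf.neg hneg)
    (h0.mono fun s hs => sub_eq_zero.1 (hsub s ▸ hs))) t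

/-- If `f` is integrable under all `P_x` and its mean vanishes on a nonempty open set, then its
mean vanishes everywhere. -/
lemma integral_slgmP_eq_zero_of_isOpen {M N : ℕ} (H : Matrix (Fin M) (Fin N) ℝ) {σ : ℝ}
    (hσ : 0 < σ) {f : (Fin M → ℝ) → ℝ} (hf : Measurable f)
    (hint : ∀ x, Integrable f (slgmP H σ x))
    {U : Set (Fin N → ℝ)} (hU : IsOpen U) (hne : U.Nonempty)
    (h0 : ∀ x ∈ U, ∫ y, f y ∂slgmP H σ x = 0) (x : Fin N → ℝ) :
    ∫ y, f y ∂slgmP H σ x = 0 := by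
  obtain ⟨x₁, hx₁⟩ := hne
  have hne : NeZero (slgmP H σ x₁) := by
    rw [slgmP_eq_pi]; infer_instance
  set d := x - x₁ with hd
  let W : (Fin M → ℝ) → ℝ := fun y => ∑ i, H.mulVec d i / σ ^ 2 * y i
  have hP : ∀ t : ℝ, slgmP H σ (x₁ + t • d) = (slgmP H σ x₁).tilted fun y => t * W y := by
    intro t
    rw [slgmP_add H hσ]
    congr 1
    ext y
    simp only [W, Matrix.mulVec_smul, Pi.smul_apply, smul_eq_mul, Finset.mul_sum]
    exact Finset.sum_congr rfl fun i _ => by ring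
  have hexp : ∀ t : ℝ, Integrable (fun y => Real.exp (t * W y)) (slgmP H σ x₁) := by
    intro t
    refine (integrable_exp_linear_slgmP H σ x₁ fun i => t * (H.mulVec d i / σ ^ 2)).congr
      (ae_of_all _ fun y => ?_)
    simp only [W, Finset.mul_sum, mul_assoc]
  have hmean : ∀ t : ℝ, ∫ y, f y ∂slgmP H σ (x₁ + t • d) =
      (∫ y, Real.exp (t * W y) ∂slgmP H σ x₁)⁻¹ *
        ∫ y, Real.exp (t * W y) * f y ∂slgmP H σ x₁ := by
    intro t
    rw [hP, integral_tilted, ← integral_const_mul]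
    congr 1
    ext y
    rw [smul_eq_mul]
    ring
  have hL : ∀ t : ℝ, ∫ y, Real.exp (t * W y) * f y ∂slgmP H σ x₁ = 0 := by
    refine integral_exp_mul_eq_zero_of_eventually hf (fun t => ?_) ?_
    · have := hint (x₁ + t • d)
      rwa [hP, integrable_tilted_iff (hexp t)] at this
    · have hcont : Tendsto (fun t : ℝ => x₁ + t • d) (𝓝 0) (𝓝 x₁) := by
        have : Continuous fun t : ℝ => x₁ + t • d := by fun_prop
        simpa using this.tendsto 0
      filter_upwards [hcont.eventually (hU.mem_nhds hx₁)] with t ht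
      have := h0 _ ht
      rw [hmean] at this
      exact (mul_eq_zero.1 this).resolve_left (inv_ne_zero (integral_exp_pos (hexp t)).ne')
  have := hmean 1
  rwa [hL, mul_zero, one_smul, hd, add_sub_cancel] at this

/-- Exact versus approximate sparsity. If the parameter set `X`
contains a nonempty open set and the mean function `γ` is valid on all of `ℝ^N`, then
prescribing the mean function only on `X` yields the same minimum achievable variance
at `x₀ ∈ X` as prescribing it on all of `ℝ^N`. -/
theorem slgm_open_set_min_variance_eq {N M : ℕ} (hN : 1 ≤ N) (hM : 1 ≤ M)
    (H : Matrix (Fin M) (Fin N) ℝ) (σ : ℝ) (hσ : 0 < σ)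
    (X : Set (Fin N → ℝ)) (hX : ∃ U : Set (Fin N → ℝ), IsOpen U ∧ U.Nonempty ∧ U ⊆ X)
    (x₀ : Fin N → ℝ) (hx₀ : x₀ ∈ X)
    (γ : (Fin N → ℝ) → ℝ)
    (hexists : ∃ g₀ : (Fin M → ℝ) → ℝ, Measurable g₀ ∧
      Integrable (fun y => g₀ y ^ 2) (slgmP H σ x₀) ∧
      ∀ x : Fin N → ℝ, Integrable g₀ (slgmP H σ x) ∧ (∫ y, g₀ y ∂ slgmP H σ x) = γ x) :
    sInf {v : ℝ | ∃ g : (Fin M → ℝ) → ℝ, Measurable g ∧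
        Integrable (fun y => g y ^ 2) (slgmP H σ x₀) ∧
        (∀ x ∈ X, Integrable g (slgmP H σ x) ∧ (∫ y, g y ∂ slgmP H σ x) = γ x) ∧
        v = slgmVar H σ g x₀}
      =
    sInf {v : ℝ | ∃ g : (Fin M → ℝ) → ℝ, Measurable g ∧
        Integrable (fun y => g y ^ 2) (slgmP H σ x₀) ∧
        (∀ x : Fin N → ℝ, Integrable g (slgmP H σ x) ∧ (∫ y, g y ∂ slgmP H σ x) = γ x) ∧
        v = slgmVar H σ g x₀} := by
  obtain ⟨U, hUo, hUne, hUX⟩ := hX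
  obtain ⟨g₀, hg₀, hg₀2, hg₀γ⟩ := hexists
  congr 1
  ext v
  refine ⟨fun ⟨g, hg, hg2, hgX, hv⟩ => ⟨g, hg, hg2, fun x => ?_, hv⟩,
    fun ⟨g, hg, hg2, hgall, hv⟩ => ⟨g, hg, hg2, fun x _ => hgall x, hv⟩⟩
  have hgi : ∀ x, Integrable g (slgmP H σ x) := fun x =>
    integrable_slgmP_of_integrable_sq H hσ x₀ x hg hg2
  have hzero := integral_slgmP_eq_zero_of_isOpen H hσ (hg.sub hg₀)
    (fun x => (hgi x).sub (hg₀γ x).1) hUo hUne (fun z hz => by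
      simp only [Pi.sub_apply]
      rw [integral_sub (hgi z) (hg₀γ z).1, (hgX z (hUX hz)).2, (hg₀γ z).2, sub_self]) x
  simp only [Pi.sub_apply] at hzero
  rw [integral_sub (hgi x) (hg₀γ x).1, (hg₀γ x).2, sub_eq_zero] at hzero
  exact ⟨hgi x, hzero⟩
end
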